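/- arXiv:2012.00444 — 2 statements merged into one kernel-verified Lean document; each statement's English description precedes it below -/
import Mathlib

section
/- For every p > 0 there exists a constant c_{d,p} > 0 depending only on d and p such that for every K ≥ 1/c_{d,p} and every n ≥ 2, the minimax risk for estimating a Gaussian location mixture density whose mixing measure has bounded p-th moment, under the squared Hellinger loss, satisfies R_n(F_{G₂(p,K)}, h²) ≥ c_{d,p}·n^{−p/(p+d)}·(log n)^{−3d/2}. -/
open MeasureTheory Real ENNReal

noncomputable def gauss (x : ℝ) : ℝ := Real.exp (-(x^2)/2) / Real.sqrt (2*Real.pi)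

noncomputable def mixDensity (d : ℕ) (G : Measure (Fin d → ℝ)) : (Fin d → ℝ) → ℝ :=
  fun x => ∫ u, ∏ i, gauss (x i - u i) ∂G

noncomputable def euclNorm (d : ℕ) (u : Fin d → ℝ) : ℝ := Real.sqrt (∑ i, (u i)^2)

/-- The class `G₂(p, K)` of mixing measures with `p`-th moment bounded by `K`:
`(∫ ‖u‖^p dG)^{1/p} ≤ K`. -/
def momentClass (d : ℕ) (p K : ℝ) : Set (Measure (Fin d → ℝ)) :=
  {G | IsProbabilityMeasure G ∧
    (∫⁻ u, ENNReal.ofReal ((euclNorm d u) ^ p) ∂G) ^ (1/p) ≤ ENNReal.ofReal K}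

/-- The class `F_{G₂(p,K)}` of Gaussian location mixtures with mixing measure in `G₂(p,K)`. -/
def gaussMixturesMoment (d : ℕ) (p K : ℝ) : Set ((Fin d → ℝ) → ℝ) :=
  {f | ∃ G ∈ momentClass d p K, f = mixDensity d G}

noncomputable def jointMeasure (d n : ℕ) (f : (Fin d → ℝ) → ℝ) :
    Measure (Fin n → Fin d → ℝ) :=
  volume.withDensity (fun X => ∏ i, ENNReal.ofReal (f (X i)))

/-- Squared Hellinger distance. -/
noncomputable def hellSq (d : ℕ) (f g : (Fin d → ℝ) → ℝ) : ℝ≥0∞ :=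
  ∫⁻ x, ENNReal.ofReal ((Real.sqrt (f x) - Real.sqrt (g x))^2)

noncomputable def minimaxRisk (d n : ℕ) (F : Set ((Fin d → ℝ) → ℝ))
    (loss : ((Fin d → ℝ) → ℝ) → ((Fin d → ℝ) → ℝ) → ℝ≥0∞) : ℝ≥0∞ :=
  ⨅ (fhat : (Fin n → Fin d → ℝ) → (Fin d → ℝ) → ℝ)
    (_ : Measurable (Function.uncurry fhat)),
    ⨆ f ∈ F, ∫⁻ X, loss (fhat X) f ∂(jointMeasure d n f)

/-- Flip the `i`-th bit. -/
def flipBit {ι : Type*} [DecidableEq ι] (i : ι) (ω : ι → Bool) : ι → Bool :=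
  Function.update ω i (!(ω i))

lemma flipBit_invol {ι : Type*} [DecidableEq ι] (i : ι) :
    Function.Involutive (flipBit (ι := ι) i) := by
  intro ω
  simp [flipBit]

lemma assouad {ι : Type} [Fintype ι] [DecidableEq ι] (d n : ℕ)
    (F : (ι → Bool) → (Fin d → ℝ) → ℝ) (g : ι → (ι → Bool) → (Fin d → ℝ) → ℝ)
    (B : ι → Set (Fin d → ℝ)) (hB : ∀ i, MeasurableSet (B i))
    (hdisj : Pairwise (Function.onFun Disjoint B))
    (hFm : ∀ ω, Measurable (F ω)) (hgm : ∀ i ω, Measurable (g i ω))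
    (hgF : ∀ i ω x, g i ω x ≤ F ω x)
    (hgF' : ∀ i ω x, g i ω x ≤ F (flipBit i ω) x)
    (δ A : ℝ≥0∞)
    (hsep : ∀ i ω, δ ≤ ∫⁻ x in B i,
      ENNReal.ofReal ((Real.sqrt (F ω x) - Real.sqrt (F (flipBit i ω) x))^2))
    (hA : ∀ i ω, A ≤ ∫⁻ X : Fin n → Fin d → ℝ, ∏ k, ENNReal.ofReal (g i ω (X k)))
    (fhat : (Fin n → Fin d → ℝ) → (Fin d → ℝ) → ℝ)
    (hfhat : Measurable (Function.uncurry fhat)) (S : ℝ≥0∞)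
    (hS : ∀ ω, ∫⁻ X, hellSq d (fhat X) (F ω) ∂(jointMeasure d n (F ω)) ≤ S) :
    (Fintype.card ι : ℝ≥0∞) * (δ * A) ≤ 4 * S := by
  set L : ι → (ι → Bool) → (Fin n → Fin d → ℝ) → ℝ≥0∞ := fun i ω X =>
    ∫⁻ x in B i, ENNReal.ofReal ((Real.sqrt (fhat X x) - Real.sqrt (F ω x))^2) with hL
  have hLint : ∀ ω, Measurable (fun q : (Fin n → Fin d → ℝ) × (Fin d → ℝ) =>
      ENNReal.ofReal ((Real.sqrt (fhat q.1 q.2) - Real.sqrt (F ω q.2))^2)) := by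
    intro ω
    have h1 : Measurable (fun q : (Fin n → Fin d → ℝ) × (Fin d → ℝ) => fhat q.1 q.2) := hfhat
    have h2 : Measurable (fun q : (Fin n → Fin d → ℝ) × (Fin d → ℝ) => F ω q.2) :=
      (hFm ω).comp measurable_snd
    exact ((h1.sqrt.sub h2.sqrt).pow_const 2).ennreal_ofReal
  have hLm : ∀ i ω, Measurable (L i ω) := fun i ω =>
    Measurable.lintegral_prod_right' (ν := volume.restrict (B i)) (hLint ω)
  have hJ : ∀ ω, Measurable (fun X : Fin n → Fin d → ℝ => ∏ k, ENNReal.ofReal (F ω (X k))) := by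
    intro ω
    exact Finset.measurable_prod _ fun k _ =>
      ((hFm ω).comp (measurable_pi_apply k)).ennreal_ofReal
  set T : ι → (ι → Bool) → ℝ≥0∞ := fun i ω => ∫⁻ X, L i ω X ∂(jointMeasure d n (F ω)) with hT
  have hTeq : ∀ i ω, T i ω = ∫⁻ X, (∏ k, ENNReal.ofReal (F ω (X k))) * L i ω X := by
    intro i ω
    simp only [hT, jointMeasure]
    rw [lintegral_withDensity_eq_lintegral_mul _ (hJ ω) (hLm i ω)]
    rfl
  have hsum : ∀ ω, ∑ i, T i ω ≤ S := by
    intro ω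
    refine le_trans ?_ (hS ω)
    simp only [hT]
    rw [← lintegral_finsetSum _ (fun i _ => hLm i ω)]
    refine lintegral_mono fun X => ?_
    simp only [hL, hellSq]
    rw [← lintegral_biUnion_finset (fun a _ b _ hab => hdisj hab) (fun i _ => hB i)]
    exact setLIntegral_le_lintegral _ _
  have hLL : ∀ i ω X, δ ≤ 2 * (L i ω X + L i (flipBit i ω) X) := by
    intro i ω X
    refine (hsep i ω).trans ?_
    simp only [hL]
    have hm : Measurable (fun x => ENNReal.ofReal
        ((Real.sqrt (fhat X x) - Real.sqrt (F ω x))^2)) :=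
      (hLint ω).comp measurable_prodMk_left
    have hm' : Measurable (fun x => ENNReal.ofReal
        ((Real.sqrt (fhat X x) - Real.sqrt (F (flipBit i ω) x))^2)) :=
      (hLint (flipBit i ω)).comp measurable_prodMk_left
    rw [← lintegral_add_left hm, ← lintegral_const_mul' _ _ (by simp : (2:ℝ≥0∞) ≠ ⊤)]
    refine lintegral_mono fun x => ?_
    simp only []
    rw [← ENNReal.ofReal_add (sq_nonneg _) (sq_nonneg _),
      show (2 : ℝ≥0∞) = ENNReal.ofReal 2 by simp, ← ENNReal.ofReal_mul (by norm_num)]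
    apply ENNReal.ofReal_le_ofReal
    nlinarith [sq_nonneg ((Real.sqrt (fhat X x) - Real.sqrt (F ω x)) +
      (Real.sqrt (fhat X x) - Real.sqrt (F (flipBit i ω) x)))]
  have hpair : ∀ i ω, δ * A ≤ 2 * (T i ω + T i (flipBit i ω)) := by
    intro i ω
    calc δ * A ≤ δ * ∫⁻ X : Fin n → Fin d → ℝ, ∏ k, ENNReal.ofReal (g i ω (X k)) := by
          gcongr; exact hA i ω
      _ = ∫⁻ X : Fin n → Fin d → ℝ, δ * ∏ k, ENNReal.ofReal (g i ω (X k)) := by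
          rw [lintegral_const_mul]
          exact Finset.measurable_prod _ fun k _ =>
            ((hgm i ω).comp (measurable_pi_apply k)).ennreal_ofReal
      _ ≤ ∫⁻ X : Fin n → Fin d → ℝ, 2 * ((∏ k, ENNReal.ofReal (F ω (X k))) * L i ω X +
            (∏ k, ENNReal.ofReal (F (flipBit i ω) (X k))) * L i (flipBit i ω) X) := by
          refine lintegral_mono fun X => ?_
          have e1 : ∏ k, ENNReal.ofReal (g i ω (X k)) ≤ ∏ k, ENNReal.ofReal (F ω (X k)) :=
            Finset.prod_le_prod' fun k _ => ENNReal.ofReal_le_ofReal (hgF i ω _)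
          have e2 : ∏ k, ENNReal.ofReal (g i ω (X k)) ≤
              ∏ k, ENNReal.ofReal (F (flipBit i ω) (X k)) :=
            Finset.prod_le_prod' fun k _ => ENNReal.ofReal_le_ofReal (hgF' i ω _)
          calc δ * ∏ k, ENNReal.ofReal (g i ω (X k))
              ≤ (2 * (L i ω X + L i (flipBit i ω) X)) * ∏ k, ENNReal.ofReal (g i ω (X k)) := by
                gcongr; exact hLL i ω X
            _ = 2 * ((∏ k, ENNReal.ofReal (g i ω (X k))) * L i ω X +
                (∏ k, ENNReal.ofReal (g i ω (X k))) * L i (flipBit i ω) X) := by ring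
            _ ≤ _ := by gcongr
      _ = 2 * (T i ω + T i (flipBit i ω)) := by
          rw [lintegral_const_mul' _ _ (by simp : (2:ℝ≥0∞) ≠ ⊤),
            lintegral_add_left ((hJ _).fun_mul (hLm _ _)), hTeq, hTeq]
  have hi : ∀ i, (Fintype.card (ι → Bool) : ℝ≥0∞) * (δ * A) ≤ 4 * ∑ ω, T i ω := by
    intro i
    calc (Fintype.card (ι → Bool) : ℝ≥0∞) * (δ * A) = ∑ _ω : ι → Bool, δ * A := by simp
      _ ≤ ∑ ω, 2 * (T i ω + T i (flipBit i ω)) := Finset.sum_le_sum fun ω _ => hpair i ω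
      _ = 2 * (∑ ω, T i ω + ∑ ω, T i (flipBit i ω)) := by
          rw [← Finset.mul_sum, Finset.sum_add_distrib]
      _ = 4 * ∑ ω, T i ω := by
          have : ∑ ω, T i (flipBit i ω) = ∑ ω, T i ω :=
            Equiv.sum_comp (flipBit_invol i).toPerm (fun ω => T i ω)
          rw [this]; ring
  have hfin : (Fintype.card (ι → Bool) : ℝ≥0∞) * ((Fintype.card ι : ℝ≥0∞) * (δ * A)) ≤
      (Fintype.card (ι → Bool) : ℝ≥0∞) * (4 * S) := by
    calc (Fintype.card (ι → Bool) : ℝ≥0∞) * ((Fintype.card ι : ℝ≥0∞) * (δ * A))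
        = ∑ _i : ι, (Fintype.card (ι → Bool) : ℝ≥0∞) * (δ * A) := by
          rw [Finset.sum_const, Finset.card_univ, nsmul_eq_mul]; ring
      _ ≤ ∑ i, 4 * ∑ ω, T i ω := Finset.sum_le_sum fun i _ => hi i
      _ = 4 * ∑ ω, ∑ i, T i ω := by rw [← Finset.mul_sum, Finset.sum_comm]
      _ ≤ 4 * ∑ _ω : ι → Bool, S := by gcongr with ω; exact hsum ω
      _ = _ := by rw [Finset.sum_const, Finset.card_univ, nsmul_eq_mul]; ring
  refine (ENNReal.mul_le_mul_iff_right ?_ (ENNReal.natCast_ne_top _)).1 hfin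
  exact_mod_cast Fintype.card_ne_zero

lemma sqrt_sep {u v e D : ℝ} (hu : 0 ≤ u) (hv : 0 ≤ v) (huD : u ≤ D) (hvD : v ≤ D) (hD : 0 < D)
    (he : 0 ≤ e) (h : e ≤ |u - v|) : e^2 / (4 * D) ≤ (Real.sqrt u - Real.sqrt v)^2 := by
  rw [div_le_iff₀ (by positivity)]
  have h1 : e^2 ≤ (u - v)^2 := by
    rw [← sq_abs (u - v)]; exact pow_le_pow_left₀ he h 2
  have hu2 := Real.sq_sqrt hu
  have hv2 := Real.sq_sqrt hv
  have h2 : (u - v)^2 = (Real.sqrt u - Real.sqrt v)^2 * (Real.sqrt u + Real.sqrt v)^2 := by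
    rw [← mul_pow]; congr 1; nlinarith
  have h3 : (Real.sqrt u + Real.sqrt v)^2 ≤ 4 * D := by
    nlinarith [sq_nonneg (Real.sqrt u - Real.sqrt v)]
  calc e^2 ≤ _ := h1
    _ = _ := h2
    _ ≤ _ := mul_le_mul_of_nonneg_left h3 (sq_nonneg _)

lemma gauss_pos (x : ℝ) : 0 < gauss x := by unfold gauss; positivity

lemma gauss_le_exp (x : ℝ) : gauss x ≤ Real.exp (-(x^2)/2) := by
  unfold gauss
  apply div_le_self (Real.exp_pos _).le
  rw [Real.one_le_sqrt]
  linarith [Real.pi_gt_three]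

lemma gauss_eq (u x : ℝ) : gauss (x - u) = ProbabilityTheory.gaussianPDFReal u 1 x := by
  simp [gauss, ProbabilityTheory.gaussianPDFReal]
  rw [div_eq_mul_inv]; ring

lemma gauss_cont : Continuous gauss := by unfold gauss; fun_prop

lemma gauss_integrable (u : ℝ) : Integrable (fun x => gauss (x - u)) := by
  simp_rw [gauss_eq]
  exact ProbabilityTheory.integrable_gaussianPDFReal u 1

lemma gauss_integral (u : ℝ) : ∫ x, gauss (x - u) = 1 := by
  simp_rw [gauss_eq]
  exact ProbabilityTheory.integral_gaussianPDFReal_eq_one u one_ne_zero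

noncomputable def Phi (d : ℕ) (x u : Fin d → ℝ) : ℝ := ∏ i, gauss (x i - u i)

lemma Phi_nonneg (d : ℕ) (x u : Fin d → ℝ) : 0 ≤ Phi d x u :=
  Finset.prod_nonneg fun _ _ => (gauss_pos _).le

lemma Phi_integrable (d : ℕ) (u : Fin d → ℝ) : Integrable (fun x => Phi d x u) :=
  Integrable.fintype_prod (f := fun i t => gauss (t - u i)) fun i => gauss_integrable (u i)

lemma Phi_integral (d : ℕ) (u : Fin d → ℝ) : ∫ x, Phi d x u = 1 := by
  unfold Phi
  rw [integral_fintype_prod_volume_eq_prod (fun i t => gauss (t - u i))]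
  simp [gauss_integral]

lemma Phi_meas (d : ℕ) (u : Fin d → ℝ) : Measurable (fun x => Phi d x u) := by
  have := gauss_cont
  apply Continuous.measurable
  unfold Phi
  fun_prop

/-- grid points -/
noncomputable def pt (d m : ℕ) (j : Fin d → Fin m) : Fin d → ℝ := fun l => 4 * ((m : ℝ) + (j l : ℕ))

noncomputable def loc (d m : ℕ) (ω : (Fin d → Fin m) → Bool) (j : Fin d → Fin m) : Fin d → ℝ :=
  if ω j then pt d m j else 0

noncomputable def gD (d m : ℕ) (w : ℝ) (i : Fin d → Fin m) (ω : (Fin d → Fin m) → Bool)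
    (x : Fin d → ℝ) : ℝ :=
  (1 - (m:ℝ)^d * w) * Phi d x 0 + w * ∑ j ∈ Finset.univ.erase i, Phi d x (loc d m ω j)

noncomputable def fD (d m : ℕ) (w : ℝ) (ω : (Fin d → Fin m) → Bool)
    (x : Fin d → ℝ) : ℝ :=
  (1 - (m:ℝ)^d * w) * Phi d x 0 + w * ∑ j, Phi d x (loc d m ω j)

lemma fD_eq (d m : ℕ) (w : ℝ) (i : Fin d → Fin m) (ω : (Fin d → Fin m) → Bool)
    (x : Fin d → ℝ) : fD d m w ω x = gD d m w i ω x + w * Phi d x (loc d m ω i) := by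
  unfold fD gD
  rw [← Finset.add_sum_erase _ _ (Finset.mem_univ i)]
  ring

lemma gD_flip (d m : ℕ) (w : ℝ) (i : Fin d → Fin m) (ω : (Fin d → Fin m) → Bool)
    (x : Fin d → ℝ) : gD d m w i (flipBit i ω) x = gD d m w i ω x := by
  unfold gD
  congr 2
  refine Finset.sum_congr rfl fun j hj => ?_
  have : flipBit i ω j = ω j := by
    simp [flipBit, Function.update_of_ne (Finset.ne_of_mem_erase hj)]
  simp [loc, this]

lemma gD_nonneg (d m : ℕ) (w : ℝ) (hw : 0 ≤ w) (hmw : (m:ℝ)^d * w ≤ 1)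
    (i : Fin d → Fin m) (ω : (Fin d → Fin m) → Bool)
    (x : Fin d → ℝ) : 0 ≤ gD d m w i ω x :=
  add_nonneg (mul_nonneg (by linarith) (Phi_nonneg _ _ _))
    (mul_nonneg hw (Finset.sum_nonneg fun _ _ => Phi_nonneg _ _ _))

lemma gD_integrable (d m : ℕ) (w : ℝ) (i : Fin d → Fin m) (ω : (Fin d → Fin m) → Bool) :
    Integrable (gD d m w i ω) :=
  ((Phi_integrable d 0).const_mul _).add
    ((integrable_finsetSum _ fun _ _ => Phi_integrable d _).const_mul w)

lemma gD_integral (d m : ℕ) (w : ℝ) (i : Fin d → Fin m) (ω : (Fin d → Fin m) → Bool) :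
    ∫ x, gD d m w i ω x = 1 - w := by
  unfold gD
  rw [integral_add ((Phi_integrable d 0).const_mul _)
    ((integrable_finsetSum _ fun _ _ => Phi_integrable d _).const_mul w),
    integral_const_mul, integral_const_mul, integral_finsetSum _ fun _ _ => Phi_integrable d _]
  simp only [Phi_integral, Finset.sum_const, Finset.card_erase_of_mem (Finset.mem_univ i)]
  have h1 : Fintype.card (Fin d → Fin m) = m^d := by simp
  have h2 : 1 ≤ m^d := by rw [← h1]; exact Fintype.card_pos_iff.2 ⟨i⟩
  simp [Nat.cast_sub h2]
  ring

lemma gD_meas (d m : ℕ) (w : ℝ) (i : Fin d → Fin m) (ω : (Fin d → Fin m) → Bool) :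
    Measurable (gD d m w i ω) :=
  ((Phi_meas d 0).const_mul _).add
    ((Finset.measurable_fun_sum _ fun _ _ => Phi_meas d _).const_mul w)

lemma fD_meas (d m : ℕ) (w : ℝ) (ω : (Fin d → Fin m) → Bool) :
    Measurable (fD d m w ω) :=
  ((Phi_meas d 0).const_mul _).add
    ((Finset.measurable_fun_sum _ fun _ _ => Phi_meas d _).const_mul w)

lemma gD_prod (d m n : ℕ) (w : ℝ) (hw : 0 ≤ w) (hmw : (m:ℝ)^d * w ≤ 1)
    (i : Fin d → Fin m) (ω : (Fin d → Fin m) → Bool) :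
    ∫⁻ X : Fin n → Fin d → ℝ, ∏ k, ENNReal.ofReal (gD d m w i ω (X k)) =
      ENNReal.ofReal ((1 - w)^n) := by
  have h0 := gD_nonneg d m w hw hmw i ω
  have h1 : ∀ X : Fin n → Fin d → ℝ, ∏ k, ENNReal.ofReal (gD d m w i ω (X k)) =
      ENNReal.ofReal (∏ k, gD d m w i ω (X k)) := fun X =>
    (ENNReal.ofReal_prod_of_nonneg fun k _ => h0 _).symm
  simp_rw [h1]
  rw [← ofReal_integral_eq_lintegral_ofReal]
  · rw [integral_fintype_prod_volume_eq_prod (fun (_ : Fin n) x => gD d m w i ω x)]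
    simp [gD_integral]
  · exact Integrable.fintype_prod (f := fun (_ : Fin n) x => gD d m w i ω x)
      fun _ => gD_integrable d m w i ω
  · exact Filter.Eventually.of_forall fun X => Finset.prod_nonneg fun k _ => h0 _

noncomputable def C1 : ℝ := ∑' r : ℤ, Real.exp (-|(r:ℝ)|)

lemma C1_summable : Summable fun r : ℤ => Real.exp (-|(r:ℝ)|) := by
  apply Summable.of_nat_of_neg
  · simpa using Real.summable_exp_neg_nat
  · simpa using Real.summable_exp_neg_nat

lemma C1_pos : 0 < C1 := C1_summable.tsum_pos (fun _ => (Real.exp_pos _).le) 0 (Real.exp_pos _)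

lemma gauss_int_le (y : ℝ) (hy : |y| ≤ 1/2) (r : ℤ) : gauss (y - 4 * r) ≤ Real.exp (-|(r:ℝ)|) := by
  refine (gauss_le_exp _).trans (Real.exp_le_exp.2 ?_)
  obtain ⟨h1, h2⟩ := abs_le.1 hy
  rcases lt_trichotomy r 0 with h | h | h
  · have : (r:ℝ) ≤ -1 := by exact_mod_cast (by omega : r ≤ -1)
    rw [abs_of_neg (by linarith)]; nlinarith
  · rw [h]; simp; nlinarith [sq_nonneg y]
  · have : (1:ℝ) ≤ r := by exact_mod_cast (by omega : 1 ≤ r)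
    rw [abs_of_pos (by linarith)]; nlinarith

lemma gauss_sum_le (m : ℕ) (i : Fin m) (x : ℝ) (hx : |x - 4 * ((m:ℝ) + (i:ℕ))| ≤ 1/2) :
    ∑ k : Fin m, gauss (x - 4 * ((m:ℝ) + (k:ℕ))) ≤ C1 := by
  let e : Fin m → ℤ := fun k => (k:ℕ) - (i:ℕ)
  have he : Function.Injective e := by
    intro a b hab
    simp only [e] at hab
    ext; omega
  calc ∑ k : Fin m, gauss (x - 4 * ((m:ℝ) + (k:ℕ)))
      ≤ ∑ k : Fin m, Real.exp (-|(e k : ℝ)|) := by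
        refine Finset.sum_le_sum fun k _ => ?_
        have := gauss_int_le _ hx (e k)
        have h2 : ((e k : ℤ) : ℝ) = (k:ℕ) - (i:ℕ) := by simp [e]
        refine le_trans (le_of_eq ?_) this
        rw [h2]; congr 1; ring
    _ = ∑ r ∈ Finset.univ.map ⟨e, he⟩, Real.exp (-|(r : ℝ)|) := by simp
    _ ≤ C1 := C1_summable.sum_le_tsum _ fun _ _ => (Real.exp_pos _).le

/-- box around a grid point -/
def box (d m : ℕ) (i : Fin d → Fin m) : Set (Fin d → ℝ) :=
  Set.Icc (fun l => pt d m i l - 1/2) (fun l => pt d m i l + 1/2)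

lemma mem_box {d m : ℕ} {i : Fin d → Fin m} {x : Fin d → ℝ} (hx : x ∈ box d m i) (l : Fin d) :
    |x l - 4 * ((m:ℝ) + (i l : ℕ))| ≤ 1/2 := by
  have h1 := hx.1 l
  have h2 := hx.2 l
  simp only [pt] at h1 h2
  rw [abs_le]; constructor <;> linarith

lemma box_vol (d m : ℕ) (i : Fin d → Fin m) : volume (box d m i) = 1 := by
  rw [box, Real.volume_Icc_pi]
  refine Finset.prod_eq_one fun l _ => ?_
  ring_nf; simp

lemma box_disj (d m : ℕ) : Pairwise (Function.onFun Disjoint (box d m)) := by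
  intro i j hij
  rw [Function.onFun, Set.disjoint_left]
  intro x hi hj
  apply hij
  ext l
  have h1 := abs_le.1 (mem_box hi l)
  have h2 := abs_le.1 (mem_box hj l)
  have h3 : ((i l : ℕ) : ℝ) < (j l : ℕ) + 1 := by linarith
  have h4 : ((j l : ℕ) : ℝ) < (i l : ℕ) + 1 := by linarith
  have h5 : (i l : ℕ) < (j l : ℕ) + 1 := by exact_mod_cast h3
  have h6 : (j l : ℕ) < (i l : ℕ) + 1 := by exact_mod_cast h4
  omega

lemma Phi_sum_le {d m : ℕ} {i : Fin d → Fin m} {x : Fin d → ℝ} (hx : x ∈ box d m i) :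
    ∑ j, Phi d x (pt d m j) ≤ C1 ^ d := by
  have h : ∑ j, Phi d x (pt d m j) = ∏ l : Fin d, ∑ k : Fin m, gauss (x l - 4 * ((m:ℝ) + (k:ℕ))) := by
    rw [Finset.prod_univ_sum]
    simp [Phi, pt]
  rw [h]
  calc _ ≤ ∏ _l : Fin d, C1 := Finset.prod_le_prod
        (fun l _ => Finset.sum_nonneg fun k _ => (gauss_pos _).le)
        (fun l _ => gauss_sum_le m (i l) (x l) (mem_box hx l))
    _ = C1 ^ d := by simp

lemma Phi_zero_le {d m : ℕ} (hd : 1 ≤ d) (hm : 1 ≤ m) {i : Fin d → Fin m} {x : Fin d → ℝ}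
    (hx : x ∈ box d m i) : Phi d x 0 ≤ Real.exp (-(2 * m)) := by
  have hm' : (1:ℝ) ≤ m := by exact_mod_cast hm
  calc Phi d x 0 ≤ ∏ _l : Fin d, Real.exp (-(2 * m)) := by
        refine Finset.prod_le_prod (fun _ _ => (gauss_pos _).le) fun l _ => ?_
        refine (gauss_le_exp _).trans (Real.exp_le_exp.2 ?_)
        have h1 := abs_le.1 (mem_box hx l)
        have h2 : (0:ℝ) ≤ (i l : ℕ) := by positivity
        have h3 : 3 * (m:ℝ) ≤ x l := by linarith
        simp only [Pi.zero_apply, sub_zero]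
        nlinarith
    _ = Real.exp (-(2 * m)) ^ d := by simp
    _ ≤ Real.exp (-(2 * m)) := by
        apply pow_le_of_le_one (Real.exp_pos _).le _ (by omega)
        rw [Real.exp_le_one_iff]; linarith

noncomputable def gam : ℝ := gauss (1/2)

lemma gam_le (y : ℝ) (hy : |y| ≤ 1/2) : gam ≤ gauss y := by
  unfold gam gauss
  have h2 : y^2 ≤ (1/2)^2 := by rw [← sq_abs y]; exact pow_le_pow_left₀ (abs_nonneg y) hy 2
  apply div_le_div_of_nonneg_right _ (Real.sqrt_nonneg _)
  apply Real.exp_le_exp.2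
  linarith

lemma gauss_half (y z : ℝ) (hy : |y| ≤ 1/2) (hz : 3 ≤ z) : gauss z ≤ 1/2 * gauss y := by
  unfold gauss
  rw [← mul_div_assoc]
  gcongr
  have h1 : Real.exp (-1) ≤ 1/2 := by
    have := Real.exp_one_gt_d9
    rw [Real.exp_neg, one_div]
    exact inv_anti₀ (by norm_num) (by linarith)
  have h2 : y^2 ≤ (1/2)^2 := by rw [← sq_abs y]; exact pow_le_pow_left₀ (abs_nonneg y) hy 2
  calc Real.exp (-z^2/2) ≤ Real.exp (-1 + -y^2/2) := Real.exp_le_exp.2 (by nlinarith)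
    _ = Real.exp (-1) * Real.exp (-y^2/2) := Real.exp_add _ _
    _ ≤ _ := by gcongr

lemma Phi_diff {d m : ℕ} (hd : 1 ≤ d) (hm : 1 ≤ m) {i : Fin d → Fin m} {x : Fin d → ℝ}
    (hx : x ∈ box d m i) : gam ^ d / 2 ≤ Phi d x (pt d m i) - Phi d x 0 := by
  have hm' : (1:ℝ) ≤ m := by exact_mod_cast hm
  have h1 : gam ^ d ≤ Phi d x (pt d m i) := by
    calc gam ^ d = ∏ _l : Fin d, gam := by simp
      _ ≤ _ := Finset.prod_le_prod (fun _ _ => (gauss_pos _).le)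
          fun l _ => gam_le _ (mem_box hx l)
  have h2 : Phi d x 0 ≤ (1/2) * Phi d x (pt d m i) := by
    calc Phi d x 0 ≤ ∏ l : Fin d, (1/2 * gauss (x l - pt d m i l)) := by
          refine Finset.prod_le_prod (fun _ _ => (gauss_pos _).le) fun l _ => ?_
          refine gauss_half _ _ (mem_box hx l) ?_
          have h1 := abs_le.1 (mem_box hx l)
          have h2 : (0:ℝ) ≤ (i l : ℕ) := by positivity
          simp only [Pi.zero_apply, sub_zero]
          linarith
      _ = (1/2)^d * Phi d x (pt d m i) := by
          rw [Finset.prod_mul_distrib]; simp [Phi]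
      _ ≤ _ := by
          apply mul_le_mul_of_nonneg_right _ (Phi_nonneg _ _ _)
          exact pow_le_of_le_one (by norm_num) (by norm_num) (by omega)
  linarith

lemma fD_nonneg (d m : ℕ) (w : ℝ) (hw : 0 ≤ w) (hmw : (m:ℝ)^d * w ≤ 1)
    (ω : (Fin d → Fin m) → Bool)
    (x : Fin d → ℝ) : 0 ≤ fD d m w ω x :=
  add_nonneg (mul_nonneg (by linarith) (Phi_nonneg _ _ _))
    (mul_nonneg hw (Finset.sum_nonneg fun _ _ => Phi_nonneg _ _ _))

lemma fD_le {d m : ℕ} {w : ℝ} (hd : 1 ≤ d) (hm : 1 ≤ m) (hw : 0 ≤ w)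
    (ω : (Fin d → Fin m) → Bool) {i : Fin d → Fin m} {x : Fin d → ℝ}
    (hx : x ∈ box d m i) : fD d m w ω x ≤ Real.exp (-(2 * m)) + w * C1 ^ d := by
  have h1 : ∑ j, Phi d x (loc d m ω j) ≤ ∑ j, (Phi d x 0 + Phi d x (pt d m j)) := by
    refine Finset.sum_le_sum fun j _ => ?_
    unfold loc
    split_ifs
    · linarith [Phi_nonneg d x 0]
    · linarith [Phi_nonneg d x (pt d m j)]
  rw [Finset.sum_add_distrib, Finset.sum_const, Finset.card_univ, nsmul_eq_mul] at h1
  have h2 : (Fintype.card (Fin d → Fin m) : ℝ) = (m:ℝ)^d := by simp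
  rw [h2] at h1
  have h3 := Phi_zero_le hd hm hx
  have h4 := mul_le_mul_of_nonneg_left (h1.trans (add_le_add_right (Phi_sum_le hx) _)) hw
  unfold fD
  nlinarith

lemma fD_diff {d m : ℕ} {w : ℝ} (hd : 1 ≤ d) (hm : 1 ≤ m) (hw : 0 ≤ w)
    (ω : (Fin d → Fin m) → Bool) {i : Fin d → Fin m} {x : Fin d → ℝ}
    (hx : x ∈ box d m i) : w * (gam ^ d / 2) ≤ |fD d m w ω x - fD d m w (flipBit i ω) x| := by
  rw [fD_eq d m w i ω, fD_eq d m w i (flipBit i ω), gD_flip]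
  have h := mul_le_mul_of_nonneg_left (Phi_diff hd hm hx) hw
  cases hb : ω i
  · have : flipBit i ω i = true := by simp [flipBit, hb]
    simp only [loc, hb, this]
    rw [abs_sub_comm]
    refine le_trans ?_ (le_abs_self _)
    simp only [if_true]
    simp
    linarith
  · have : flipBit i ω i = false := by simp [flipBit, hb]
    simp only [loc, hb, this]
    refine le_trans ?_ (le_abs_self _)
    simp
    linarith

lemma fD_sep {d m : ℕ} {w C : ℝ} (hd : 1 ≤ d) (hm : 1 ≤ m) (hw : 0 < w) (hC : 0 < C)
    (hmw : (m:ℝ)^d * w ≤ 1) (hexp : Real.exp (-(2 * m)) + w * C1 ^ d ≤ C * w)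
    (ω : (Fin d → Fin m) → Bool) (i : Fin d → Fin m) :
    ENNReal.ofReal (w * (gam ^ d / 2)^2 / (4 * C)) ≤ ∫⁻ x in box d m i,
      ENNReal.ofReal ((Real.sqrt (fD d m w ω x) - Real.sqrt (fD d m w (flipBit i ω) x))^2) := by
  calc ENNReal.ofReal (w * (gam ^ d / 2)^2 / (4 * C))
      = ∫⁻ _x in box d m i, ENNReal.ofReal (w * (gam ^ d / 2)^2 / (4 * C)) := by
        rw [setLIntegral_const, box_vol, mul_one]
    _ ≤ _ := by
        refine setLIntegral_mono' measurableSet_Icc fun x hx => ?_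
        apply ENNReal.ofReal_le_ofReal
        have hg : 0 < gam := gauss_pos _
        have := sqrt_sep (fD_nonneg d m w hw.le hmw ω x)
          (fD_nonneg d m w hw.le hmw (flipBit i ω) x)
          ((fD_le hd hm hw.le ω hx).trans hexp) ((fD_le hd hm hw.le _ hx).trans hexp)
          (by positivity) (by positivity) (fD_diff hd hm hw.le ω hx)
        refine le_trans (le_of_eq ?_) this
        field_simp

noncomputable def mixG (d m : ℕ) (w : ℝ) (ω : (Fin d → Fin m) → Bool) : Measure (Fin d → ℝ) :=
  ENNReal.ofReal (1 - (m:ℝ)^d * w) • Measure.dirac 0 +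
    ∑ j, ENNReal.ofReal w • Measure.dirac (loc d m ω j)

lemma mixG_density (d m : ℕ) (w : ℝ) (hw : 0 ≤ w) (hmw : (m:ℝ)^d * w ≤ 1)
    (ω : (Fin d → Fin m) → Bool) : mixDensity d (mixG d m w ω) = fD d m w ω := by
  funext x
  have hi : ∀ (c : ℝ) (a : Fin d → ℝ),
      Integrable (fun u : Fin d → ℝ => ∏ i, gauss (x i - u i))
        (ENNReal.ofReal c • Measure.dirac a) := by
    intro c a
    exact (integrable_dirac (by simp)).smul_measure ENNReal.ofReal_ne_top
  unfold mixDensity mixG fD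
  rw [integral_add_measure (hi _ _) (integrable_finsetSum_measure.2 fun j _ => hi _ _),
    integral_finsetSum_measure fun j _ => hi _ _]
  simp only [integral_smul_measure, integral_dirac, ENNReal.toReal_ofReal hw,
    ENNReal.toReal_ofReal (sub_nonneg.2 hmw), smul_eq_mul, Finset.mul_sum]
  rfl

lemma norm_loc_le (d m : ℕ) (ω : (Fin d → Fin m) → Bool) (j : Fin d → Fin m) :
    euclNorm d (loc d m ω j) ≤ 8 * d * m := by
  unfold euclNorm
  apply Real.sqrt_le_iff.2 ⟨by positivity, ?_⟩
  calc ∑ l, (loc d m ω j l)^2 ≤ ∑ _l : Fin d, (8 * (m:ℝ))^2 := by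
        refine Finset.sum_le_sum fun l _ => ?_
        unfold loc
        split_ifs
        · have : ((j l : ℕ) : ℝ) ≤ m := by exact_mod_cast (j l).2.le
          apply pow_le_pow_left₀
          · simp only [pt]; positivity
          · simp only [pt]; linarith
        · simp
    _ = d * (8 * (m:ℝ))^2 := by simp
    _ ≤ (d:ℝ)^2 * (8 * (m:ℝ))^2 := by
        gcongr
        exact_mod_cast Nat.le_self_pow two_ne_zero d
    _ = _ := by ring

lemma mixG_mem (d m : ℕ) (w p K : ℝ) (hp : 0 < p) (hw : 0 ≤ w) (hmw : (m:ℝ)^d * w ≤ 1)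
    (hK : 8 * d ≤ K) (hmp : (m:ℝ)^d * w * (m:ℝ)^p ≤ 1)
    (ω : (Fin d → Fin m) → Bool) : mixG d m w ω ∈ momentClass d p K := by
  constructor
  · constructor
    simp only [mixG, Measure.coe_add, Measure.coe_smul, Pi.add_apply, Pi.smul_apply,
      Measure.coe_finsetSum, Finset.sum_apply, measure_univ, smul_eq_mul, mul_one,
      Finset.sum_const, Finset.card_univ, nsmul_eq_mul]
    have h2 : ((Fintype.card (Fin d → Fin m) : ℕ) : ℝ≥0∞) = ENNReal.ofReal ((m:ℝ)^d) := by
      rw [← ENNReal.ofReal_natCast]; simp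
    rw [h2, ← ENNReal.ofReal_mul (by positivity),
      ← ENNReal.ofReal_add (by linarith) (by positivity)]
    simp
  · have hmain : ∫⁻ u, ENNReal.ofReal ((euclNorm d u) ^ p) ∂(mixG d m w ω) ≤
        ENNReal.ofReal ((8 * d)^p) := by
      unfold mixG
      rw [lintegral_add_measure, lintegral_finsetSum_measure]
      simp only [lintegral_smul_measure, lintegral_dirac, smul_eq_mul]
      have h0 : euclNorm d 0 = 0 := by simp [euclNorm]
      rw [h0, Real.zero_rpow hp.ne', ENNReal.ofReal_zero, mul_zero, zero_add]
      calc ∑ j, ENNReal.ofReal w * ENNReal.ofReal (euclNorm d (loc d m ω j) ^ p)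
          ≤ ∑ _j : Fin d → Fin m, ENNReal.ofReal w * ENNReal.ofReal ((8 * d * m) ^ p) := by
            gcongr with j
            · exact Real.sqrt_nonneg _
            · exact norm_loc_le d m ω j
        _ = ENNReal.ofReal ((m:ℝ)^d * w * (m:ℝ)^p * (8 * d)^p) := by
            have h2 : ((Fintype.card (Fin d → Fin m) : ℕ) : ℝ≥0∞) = ENNReal.ofReal ((m:ℝ)^d) := by
              rw [← ENNReal.ofReal_natCast]; simp
            rw [Finset.sum_const, Finset.card_univ, nsmul_eq_mul, h2, ← ENNReal.ofReal_mul hw,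
              ← ENNReal.ofReal_mul (by positivity), Real.mul_rpow (by positivity) (by positivity)]
            congr 1; ring
        _ ≤ _ := by
            apply ENNReal.ofReal_le_ofReal
            exact mul_le_of_le_one_left (by positivity) hmp
    calc _ ≤ (ENNReal.ofReal ((8 * d)^p)) ^ (1/p) := by gcongr
      _ = ENNReal.ofReal (8 * d) := by
          rw [ENNReal.ofReal_rpow_of_nonneg (by positivity) (by positivity),
            ← Real.rpow_mul (by positivity), mul_one_div_cancel hp.ne', Real.rpow_one]
      _ ≤ _ := ENNReal.ofReal_le_ofReal hK

lemma choose_m (d n : ℕ) (hn : 2 ≤ n) (p : ℝ) (hp : 0 < p) :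
    ∃ m : ℕ, 1 ≤ m ∧ (m:ℝ) ^ (p + d) ≤ n ∧ (n:ℝ) ≤ (2 * m) ^ (p + d) ∧
      (n:ℝ) ^ (1 / (p + d)) ≤ 2 * m := by
  have hq : 0 < p + d := by positivity
  have hn1 : (1:ℝ) ≤ n := by exact_mod_cast (by omega : 1 ≤ n)
  have hn0 : (0:ℝ) ≤ n := by linarith
  have ht1 : 1 ≤ (n:ℝ) ^ (1 / (p + d)) := Real.one_le_rpow hn1 (by positivity)
  have ht : ((n:ℝ) ^ (1 / (p + d))) ^ (p + d) = n := by
    rw [← Real.rpow_mul hn0, one_div_mul_cancel hq.ne', Real.rpow_one]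
  have hm1 : 1 ≤ ⌊(n:ℝ) ^ (1 / (p + d))⌋₊ := Nat.one_le_floor_iff _ |>.2 ht1
  have hm1' : (1:ℝ) ≤ (⌊(n:ℝ) ^ (1 / (p + d))⌋₊ : ℝ) := by exact_mod_cast hm1
  have h2 : (n:ℝ) ^ (1 / (p + d)) ≤ 2 * (⌊(n:ℝ) ^ (1 / (p + d))⌋₊ : ℝ) := by
    have := Nat.lt_floor_add_one ((n:ℝ) ^ (1 / (p + d)))
    linarith
  refine ⟨⌊(n:ℝ) ^ (1 / (p + d))⌋₊, hm1, ?_, ?_, h2⟩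
  · calc _ ≤ ((n:ℝ) ^ (1 / (p + d))) ^ (p + d) :=
        Real.rpow_le_rpow (by positivity) (Nat.floor_le (by linarith)) hq.le
      _ = n := ht
  · calc (n:ℝ) = ((n:ℝ) ^ (1 / (p + d))) ^ (p + d) := ht.symm
      _ ≤ _ := Real.rpow_le_rpow (by linarith) h2 hq.le

lemma exp_bound (d n m : ℕ) (hn : 2 ≤ n) (hm : 1 ≤ m) (p : ℝ)
    (h : (n:ℝ) ≤ (2 * m) ^ (p + d)) :
    Real.exp (-(2 * m)) ≤ 2 * (⌈p + d⌉₊.factorial : ℝ) * (1 / (2 * n)) := by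
  have hm' : (1:ℝ) ≤ m := by exact_mod_cast hm
  have hn0 : (0:ℝ) < n := by exact_mod_cast (by omega : 0 < n)
  have hf : (0:ℝ) < (⌈p + d⌉₊.factorial : ℝ) := by positivity
  have h1 : (n:ℝ) ≤ (2 * (m:ℝ)) ^ ⌈p + d⌉₊ := by
    refine h.trans ?_
    rw [← Real.rpow_natCast]
    exact Real.rpow_le_rpow_of_exponent_le (by linarith) (Nat.le_ceil _)
  have h2 := Real.pow_div_factorial_le_exp (2 * (m:ℝ)) (by positivity) ⌈p + d⌉₊
  rw [div_le_iff₀ hf] at h2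
  have h3 : 2 * (⌈p + d⌉₊.factorial : ℝ) * (1 / (2 * n)) = (⌈p + d⌉₊.factorial : ℝ) / n := by
    field_simp
  rw [h3, le_div_iff₀ hn0, Real.exp_neg, inv_mul_le_iff₀ (Real.exp_pos _)]
  linarith

lemma final_count (d n m : ℕ) (hn : 2 ≤ n) (p : ℝ) (hp : 0 < p)
    (h : (n:ℝ) ^ (1 / (p + d)) ≤ 2 * m) :
    (n:ℝ) ^ (-(p / (p + d))) ≤ 2 ^ d * ((m:ℝ)^d / n) := by
  have hn0 : (0:ℝ) < n := by exact_mod_cast (by omega : 0 < n)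
  have hq : 0 < p + d := by positivity
  have h1 := pow_le_pow_left₀ (by positivity) h d
  rw [mul_pow, ← Real.rpow_natCast, ← Real.rpow_mul hn0.le] at h1
  have h2 : -(p / (p + d)) = 1 / (p + d) * d - 1 := by field_simp; ring
  rw [h2, Real.rpow_sub hn0, Real.rpow_one, ← mul_div_assoc]
  gcongr

theorem stmt2 (d : ℕ) (hd : 1 ≤ d) (p : ℝ) (hp : 0 < p) :
    ∃ c : ℝ, 0 < c ∧ ∀ K : ℝ, 1/c ≤ K → ∀ n : ℕ, 2 ≤ n →
      ENNReal.ofReal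
          (c * (n : ℝ) ^ (-(p/(p + d))) * (Real.log n) ^ (-(3 * (d : ℝ)/2)))
        ≤ minimaxRisk d n (gaussMixturesMoment d p K) (hellSq d) := by
  set Q : ℝ := 2 * (⌈p + d⌉₊.factorial : ℝ) + C1 ^ d with hQ
  have hC1 := C1_pos
  have hg : 0 < gam := gauss_pos _
  have hQ0 : 0 < Q := by positivity
  have hlog2 : 0 < Real.log 2 := Real.log_pos (by norm_num)
  have hd0 : (0:ℝ) < d := by exact_mod_cast hd
  set c0 : ℝ := (gam ^ d / 2)^2 / (64 * Q * 2 ^ d) with hc0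
  have hc0' : 0 < c0 := by positivity
  set c : ℝ := min (1 / (8 * d)) (c0 * (Real.log 2) ^ (3 * (d:ℝ)/2)) with hc
  have hcpos : 0 < c := by
    apply lt_min <;> positivity
  refine ⟨c, hcpos, fun K hK n hn => ?_⟩
  have hn0 : (0:ℝ) < n := by exact_mod_cast (by omega : 0 < n)
  have hK8 : 8 * (d:ℝ) ≤ K := by
    refine le_trans ?_ hK
    rw [le_div_iff₀ hcpos]
    calc 8 * (d:ℝ) * c ≤ 8 * d * (1 / (8 * d)) := by gcongr; exact min_le_left _ _
      _ = 1 := by field_simp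
  obtain ⟨m, hm1, hmn, hnm, hroot⟩ := choose_m d n hn p hp
  have hm0 : (1:ℝ) ≤ m := by exact_mod_cast hm1
  set w : ℝ := 1 / (2 * n) with hw
  have hw0 : 0 < w := by positivity
  have hmp : (m:ℝ)^d * w * (m:ℝ)^p ≤ 1 := by
    have h1 : (m:ℝ)^p * (m:ℝ)^d ≤ n := by
      rw [← Real.rpow_natCast (m:ℝ) d, ← Real.rpow_add (by linarith)]; exact hmn
    calc (m:ℝ)^d * w * (m:ℝ)^p = ((m:ℝ)^p * (m:ℝ)^d) * w := by ring
      _ ≤ n * w := by gcongr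
      _ = 1/2 := by rw [hw]; field_simp
      _ ≤ 1 := by norm_num
  have hmw : (m:ℝ)^d * w ≤ 1 := by
    refine le_trans ?_ hmp
    exact le_mul_of_one_le_right (by positivity) (Real.one_le_rpow hm0 hp.le)
  have hexp : Real.exp (-(2 * m)) + w * C1 ^ d ≤ Q * w := by
    have := exp_bound d n m hn hm1 p hnm
    rw [hQ]; linarith
  unfold minimaxRisk
  refine le_iInf fun fhat => le_iInf fun hfhat => ?_
  set S : ℝ≥0∞ := ⨆ f ∈ gaussMixturesMoment d p K,
    ∫⁻ X, hellSq d (fhat X) f ∂(jointMeasure d n f) with hS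
  have hA : ∀ (i : Fin d → Fin m) (ω : (Fin d → Fin m) → Bool), ENNReal.ofReal (1/2) ≤
      ∫⁻ X : Fin n → Fin d → ℝ, ∏ k, ENNReal.ofReal (gD d m w i ω (X k)) := by
    intro i ω
    rw [gD_prod d m n w hw0.le hmw i ω]
    apply ENNReal.ofReal_le_ofReal
    have hw1 : w ≤ 1 := by
      rw [hw, div_le_one (by positivity)]
      have : (2:ℝ) ≤ n := by exact_mod_cast hn
      linarith
    have h1 := one_add_mul_le_pow (a := -w) (by linarith) n
    have h2 : (n:ℝ) * w = 1/2 := by rw [hw]; field_simp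
    rw [← sub_eq_add_neg] at h1
    linarith
  have key := assouad d n (fD d m w) (gD d m w) (box d m) (fun _ => measurableSet_Icc)
    (box_disj d m) (fD_meas d m w) (gD_meas d m w)
    (fun i ω x => by
      rw [fD_eq d m w i ω x]
      have := mul_nonneg hw0.le (Phi_nonneg d x (loc d m ω i))
      linarith)
    (fun i ω x => by
      rw [fD_eq d m w i (flipBit i ω) x, gD_flip]
      have := mul_nonneg hw0.le (Phi_nonneg d x (loc d m (flipBit i ω) i))
      linarith)
    (ENNReal.ofReal (w * (gam ^ d / 2)^2 / (4 * Q))) (ENNReal.ofReal (1/2))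
    (fun i ω => fD_sep hd hm1 hw0 hQ0 hmw hexp ω i) hA fhat hfhat S
    (fun ω => by
      rw [hS]
      exact le_iSup₂ (f := fun f (_ : f ∈ gaussMixturesMoment d p K) =>
        ∫⁻ X, hellSq d (fhat X) f ∂(jointMeasure d n f)) (fD d m w ω)
        ⟨mixG d m w ω, mixG_mem d m w p K hp hw0.le hmw hK8 hmp ω,
          (mixG_density d m w hw0.le hmw ω).symm⟩)
  have hcard : ((Fintype.card (Fin d → Fin m) : ℕ) : ℝ≥0∞) = ENNReal.ofReal ((m:ℝ)^d) := by
    rw [← ENNReal.ofReal_natCast]; simp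
  rw [hcard, ← ENNReal.ofReal_mul (by positivity), ← ENNReal.ofReal_mul (by positivity)] at key
  have hfour : (4:ℝ≥0∞) = ENNReal.ofReal 4 := by simp
  refine (ENNReal.mul_le_mul_iff_right (a := 4) (by simp) (by simp)).1 (le_trans ?_ key)
  rw [hfour, ← ENNReal.ofReal_mul (by norm_num)]
  apply ENNReal.ofReal_le_ofReal
  have hlogn : (Real.log n) ^ (-(3 * (d : ℝ)/2)) ≤ (Real.log 2) ^ (-(3 * (d : ℝ)/2)) := by
    apply Real.rpow_le_rpow_of_nonpos hlog2
    · exact Real.log_le_log (by norm_num) (by exact_mod_cast hn)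
    · have : 0 < 3 * (d:ℝ)/2 := by positivity
      linarith
  have hcount := final_count d n m hn p hp hroot
  calc 4 * (c * (n : ℝ) ^ (-(p/(p + d))) * (Real.log n) ^ (-(3 * (d : ℝ)/2)))
      ≤ 4 * ((c0 * (Real.log 2) ^ (3 * (d:ℝ)/2)) * (2 ^ d * ((m:ℝ)^d / n)) *
          (Real.log 2) ^ (-(3 * (d : ℝ)/2))) := by
        have hcle : c ≤ c0 * (Real.log 2) ^ (3 * (d:ℝ)/2) := min_le_right _ _
        have hx : 0 ≤ (Real.log n) ^ (-(3 * (d : ℝ)/2)) :=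
          Real.rpow_nonneg (Real.log_natCast_nonneg n) _
        gcongr
    _ = 4 * (c0 * (2 ^ d * ((m:ℝ)^d / n))) := by
        rw [Real.rpow_neg hlog2.le]
        have : (Real.log 2) ^ (3 * (d:ℝ)/2) ≠ 0 := (Real.rpow_pos_of_pos hlog2 _).ne'
        field_simp
    _ = (m:ℝ)^d * (w * (gam ^ d / 2)^2 / (4 * Q) * (1/2)) := by
        rw [hc0, hw]
        field_simp
        norm_num
    _ ≤ _ := le_rfl
end

section
/- Let f be any probability density on ℝ^d, let X_1,…,X_n be i.i.d. with density f, and let f̂_n be the sinc kernel estimator with bandwidth h > 0. Then the integrated variance satisfies E_f ∫ (f̂_n(x) − E_f f̂_n(x))² dx ≤ π^{−d}/(n h^d). -/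
open MeasureTheory Real ENNReal

/-- A probability density on ℝ^d. -/
def IsDensity (d : ℕ) (f : (Fin d → ℝ) → ℝ) : Prop :=
  Measurable f ∧ (∀ x, 0 ≤ f x) ∧ (∫⁻ x, ENNReal.ofReal (f x)) = 1

/-- The sinc kernel `K(y) = sin y / (π y)` (with its continuous value `1/π` at `0`). -/
noncomputable def sincK (y : ℝ) : ℝ :=
  if y = 0 then 1 / Real.pi else Real.sin y / (Real.pi * y)

/-- The sinc kernel density estimator with bandwidth `h` based on samples `X 0, …, X (n-1)`. -/
noncomputable def sincEst (d n : ℕ) (h : ℝ) (X : Fin n → Fin d → ℝ)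
    (x : Fin d → ℝ) : ℝ :=
  (1 / (n * h^d)) * ∑ i : Fin n, ∏ j : Fin d, sincK ((X i j - x j) / h)

/-- The pointwise mean `E_f f̂_n(x)` of the sinc kernel estimator. -/
noncomputable def sincEstMean (d n : ℕ) (f : (Fin d → ℝ) → ℝ) (h : ℝ)
    (x : Fin d → ℝ) : ℝ :=
  ∫ X, sincEst d n h X x ∂(jointMeasure d n f)

lemma lint_prod_fin {n : ℕ} {E : Type*} [MeasurableSpace E] (μ : Fin n → Measure E)
    [∀ i, SigmaFinite (μ i)] (g : Fin n → E → ℝ≥0∞) (hg : ∀ i, Measurable (g i)) :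
    ∫⁻ x : Fin n → E, ∏ i, g i (x i) ∂(Measure.pi μ) = ∏ i, ∫⁻ x, g i x ∂(μ i) := by
  induction n with
  | zero => simp
  | succ n n_ih =>
      calc
        _ = ∫⁻ x : E × (Fin n → E), g 0 x.1 * ∏ i : Fin n, g (Fin.succ i) (x.2 i)
            ∂((μ 0).prod (Measure.pi (fun i ↦ μ i.succ))) := by
          rw [← ((measurePreserving_piFinSuccAbove μ 0).symm).lintegral_comp_emb
            (MeasurableEquiv.measurableEmbedding _)]
          refine lintegral_congr fun x => ?_
          rw [Fin.prod_univ_succ]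
          rfl
        _ = (∫⁻ x, g 0 x ∂μ 0)
            * ∏ i : Fin n, ∫⁻ x, g (Fin.succ i) x ∂(μ i.succ) := by
          rw [← n_ih _ _ (fun i => hg _), ← lintegral_prod_mul (hg 0).aemeasurable]
          exact (Finset.measurable_prod _ fun i _ =>
            (hg _).comp (measurable_pi_apply i)).aemeasurable
        _ = ∏ i, ∫⁻ x, g i x ∂(μ i) := by rw [Fin.prod_univ_succ]

lemma joint_eq_pi (d n : ℕ) (f : (Fin d → ℝ) → ℝ) (hf : IsDensity d f)
    [IsProbabilityMeasure (volume.withDensity (fun x => ENNReal.ofReal (f x)))] :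
    jointMeasure d n f =
      Measure.pi (fun _ : Fin n => volume.withDensity (fun x => ENNReal.ofReal (f x))) := by
  symm
  apply Measure.pi_eq
  intro s hs
  rw [jointMeasure, withDensity_apply _ (MeasurableSet.univ_pi hs), volume_pi,
    Measure.restrict_pi_pi, lint_prod_fin _ (fun _ x => ENNReal.ofReal (f x))
      (fun _ => hf.1.ennreal_ofReal)]
  exact Finset.prod_congr rfl fun i _ => (withDensity_apply _ (hs i)).symm

lemma coeff_eq (u : ℝ) (n : ℤ) :
    fourierCoeffOn (show (-1:ℝ) < 1 by norm_num) (fun x : ℝ => Complex.exp ((u * x : ℝ) * Complex.I)) n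
      = (Real.sinc (u - n * π) : ℝ) := by
  rw [fourierCoeffOn_eq_integral]
  have h1 : ∀ x : ℝ, (fourier (-n) (x : AddCircle ((1:ℝ) - (-1))) : ℂ) •
      Complex.exp ((u * x : ℝ) * Complex.I)
      = (fun t : ℝ => Complex.exp (t * Complex.I)) ((u - n * π) * x) := by
    intro x
    rw [fourier_coe_apply, smul_eq_mul, ← Complex.exp_add]
    congr 1
    push_cast
    ring
  simp_rw [h1]
  by_cases h0 : u - n * π = 0
  · simp [h0]; norm_num
  rw [intervalIntegral.integral_comp_mul_left (fun t : ℝ => Complex.exp (t * Complex.I)) h0]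
  have := integral_exp_mul_I_eq_sinc (u - n * π)
  rw [mul_neg, mul_one, this]
  have h0' : ((u:ℂ) - n * π) ≠ 0 := by exact_mod_cast h0
  simp only [Complex.real_smul]
  push_cast
  field_simp
  norm_num

lemma sum_sinc (u : ℝ) : HasSum (fun n : ℤ => (Real.sinc (u - n * π))^2) 1 := by
  have hm : MemLp (fun x : ℝ => Complex.exp ((u * x : ℝ) * Complex.I)) 2
      (volume.restrict (Set.Ioc (-1) 1)) := by
    refine MemLp.of_bound (C := 1) (Continuous.aestronglyMeasurable (by fun_prop)) ?_
    exact Filter.Eventually.of_forall fun x => by rw [Complex.norm_exp_ofReal_mul_I]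
  have := hasSum_sq_fourierCoeffOn (show (-1:ℝ) < 1 by norm_num) hm
  simp only [coeff_eq, Complex.norm_exp_ofReal_mul_I, Complex.norm_real, Real.norm_eq_abs,
    sq_abs] at this
  convert! this using 1
  norm_num

lemma lint_sinc : ∫⁻ x : ℝ, ENNReal.ofReal (Real.sinc x ^ 2) = ENNReal.ofReal π := by
  rw [← setLIntegral_univ, ← iUnion_Ioc_zsmul Real.pi_pos,
    lintegral_iUnion (fun _ => measurableSet_Ioc) (Set.pairwise_disjoint_Ioc_zsmul π)]
  have h1 : ∀ n : ℤ, ∫⁻ x in Set.Ioc (n • π) ((n+1) • π), ENNReal.ofReal (Real.sinc x ^ 2)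
      = ∫⁻ x in Set.Ioc 0 π, ENNReal.ofReal (Real.sinc (x - ((-n : ℤ) : ℝ) * π) ^ 2) := by
    intro n
    rw [← (measurePreserving_add_right volume ((n:ℝ) * π)).setLIntegral_comp_preimage_emb
      (MeasurableEquiv.addRight ((n:ℝ) * π)).measurableEmbedding]
    have : (fun x => x + (n:ℝ) * π) ⁻¹' Set.Ioc (n • π) ((n+1) • π) = Set.Ioc 0 π := by
      ext x
      simp only [Set.mem_preimage, Set.mem_Ioc, zsmul_eq_mul]
      push_cast
      constructor <;> rintro ⟨h1, h2⟩ <;> constructor <;> linarith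
    rw [this]
    refine lintegral_congr fun x => ?_
    push_cast
    congr 3
    ring
  simp_rw [h1]
  rw [← lintegral_tsum (fun n => by
    have := Real.measurable_sinc
    fun_prop)]
  have h2 : ∀ x : ℝ, ∑' n : ℤ, ENNReal.ofReal (Real.sinc (x - ((-n : ℤ) : ℝ) * π) ^ 2) = 1 := by
    intro x
    refine ((Equiv.neg ℤ).tsum_eq
      (fun n : ℤ => ENNReal.ofReal (Real.sinc (x - (n : ℝ) * π) ^ 2))).trans ?_
    rw [← ENNReal.ofReal_tsum_of_nonneg (fun _ => sq_nonneg _) (sum_sinc x).summable,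
      (sum_sinc x).tsum_eq, ENNReal.ofReal_one]
  simp_rw [h2]
  simp

lemma sincK_eq (y : ℝ) : sincK y = π⁻¹ * Real.sinc y := by
  rw [sincK, Real.sinc_apply]
  split_ifs
  · simp
  · field_simp

lemma measurable_sincK : Measurable sincK := by
  have := Real.measurable_sinc
  rw [funext sincK_eq]
  fun_prop

lemma lint_sincK (a h : ℝ) (hh : 0 < h) :
    ∫⁻ x : ℝ, ENNReal.ofReal (sincK ((a - x) / h) ^ 2) = ENNReal.ofReal (h / π) := by
  rw [lintegral_sub_left_eq_self (fun y => ENNReal.ofReal (sincK (y / h) ^ 2)) a]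
  have hm := measurable_sincK
  have h1 := lintegral_map (μ := volume) (f := fun y => ENNReal.ofReal (sincK y ^ 2))
    (g := fun x => x * h⁻¹) (by fun_prop) (by fun_prop)
  rw [Real.map_volume_mul_right (inv_ne_zero hh.ne'), lintegral_smul_measure, inv_inv,
    abs_of_pos hh] at h1
  simp_rw [div_eq_mul_inv]
  rw [← h1]
  simp_rw [sincK_eq, mul_pow, ENNReal.ofReal_mul (sq_nonneg π⁻¹)]
  rw [lintegral_const_mul _ (by have := Real.measurable_sinc; fun_prop), lint_sinc, smul_eq_mul,
    ← ENNReal.ofReal_mul (by positivity), ← ENNReal.ofReal_mul (by positivity)]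
  congr 1
  have := Real.pi_ne_zero
  field_simp

lemma lint_prodK (d : ℕ) (y : Fin d → ℝ) (h : ℝ) (hh : 0 < h) :
    ∫⁻ x : Fin d → ℝ, ENNReal.ofReal ((∏ j, sincK ((y j - x j) / h)) ^ 2)
      = ENNReal.ofReal ((h / π) ^ d) := by
  have hm := measurable_sincK
  simp_rw [← Finset.prod_pow, ENNReal.ofReal_prod_of_nonneg (fun _ _ => sq_nonneg _)]
  rw [volume_pi, lint_prod_fin _ (fun j x => ENNReal.ofReal (sincK ((y j - x) / h) ^ 2))
    (fun j => by fun_prop)]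
  simp_rw [lint_sincK _ h hh]
  simp [ENNReal.ofReal_pow (div_pos hh Real.pi_pos).le]

lemma abs_sincK_le (y : ℝ) : |sincK y| ≤ 1 := by
  rw [sincK_eq, abs_mul, abs_of_pos (inv_pos.2 Real.pi_pos)]
  have h1 : π⁻¹ ≤ 1 := inv_le_one_of_one_le₀ (by linarith [Real.pi_gt_three])
  exact mul_le_one₀ h1 (abs_nonneg _) (Real.abs_sinc_le_one y)

open ProbabilityTheory in
theorem stmt5 (d n : ℕ) (hd : 1 ≤ d) (hn : 1 ≤ n)
    (f : (Fin d → ℝ) → ℝ) (hf : IsDensity d f) (h : ℝ) (hh : 0 < h) :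
    (∫⁻ X, (∫⁻ x, ENNReal.ofReal ((sincEst d n h X x - sincEstMean d n f h x)^2))
        ∂(jointMeasure d n f))
      ≤ ENNReal.ofReal (Real.pi ^ (-(d : ℝ)) / (n * h^d)) := by
  have hK := measurable_sincK
  set μ : Measure (Fin d → ℝ) := volume.withDensity (fun x => ENNReal.ofReal (f x)) with hμ
  have hp : IsProbabilityMeasure μ := ⟨by
    rw [hμ, withDensity_apply _ MeasurableSet.univ, setLIntegral_univ, hf.2.2]⟩
  have hJ : jointMeasure d n f = Measure.pi (fun _ : Fin n => μ) := joint_eq_pi d n f hf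
  have hmE : Measurable (fun p : (Fin n → Fin d → ℝ) × (Fin d → ℝ) => sincEst d n h p.1 p.2) := by
    unfold sincEst
    fun_prop
  have hmM : Measurable (sincEstMean d n f h) := by
    unfold sincEstMean
    rw [hJ]
    exact (hmE.comp measurable_swap).stronglyMeasurable.integral_prod_right'.measurable
  have hn0 : (0:ℝ) < n := by exact_mod_cast hn
  set c : ℝ := 1 / (n * h ^ d) with hc
  have hc0 : 0 < c := by positivity
  let G : (Fin d → ℝ) → (Fin d → ℝ) → ℝ := fun x y => ∏ j, sincK ((y j - x j) / h)
  have hG : ∀ x, MemLp (G x) 2 μ := by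
    intro x
    refine MemLp.of_bound (C := 1) (Measurable.aestronglyMeasurable (by fun_prop)) ?_
    refine Filter.Eventually.of_forall fun y => ?_
    rw [Real.norm_eq_abs, Finset.abs_prod]
    exact Finset.prod_le_one (fun _ _ => abs_nonneg _) (fun _ _ => abs_sincK_le _)
  rw [hJ, lintegral_lintegral_swap (by
    apply Measurable.aemeasurable
    have : Measurable (fun p : (Fin n → Fin d → ℝ) × (Fin d → ℝ) =>
      sincEstMean d n f h p.2) := hmM.comp measurable_snd
    exact ((hmE.sub this).pow_const 2).ennreal_ofReal)]
  have key : ∀ x, ∫⁻ X, ENNReal.ofReal ((sincEst d n h X x - sincEstMean d n f h x)^2)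
      ∂(Measure.pi (fun _ : Fin n => μ))
      ≤ ENNReal.ofReal (c ^ 2 * n) * ∫⁻ y, ENNReal.ofReal (G x y ^ 2) ∂μ := by
    intro x
    have e1 : (fun X => sincEst d n h X x) =
        fun X => c * (∑ i, fun X : Fin n → Fin d → ℝ => G x (X i)) X := by
      ext X
      simp [sincEst, hc, G]
    have hS : MemLp (∑ i, fun X : Fin n → Fin d → ℝ => G x (X i)) 2
        (Measure.pi (fun _ : Fin n => μ)) :=
      memLp_finsetSum' _ fun i _ =>
        (hG x).comp_measurePreserving (measurePreserving_eval (fun _ : Fin n => μ) i)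
    have hv := evariance_eq_lintegral_ofReal (fun X => sincEst d n h X x)
      (Measure.pi (fun _ : Fin n => μ))
    unfold sincEstMean
    rw [hJ, ← hv, e1, ← (hS.const_mul c).ofReal_variance_eq, variance_const_mul,
      variance_sum_pi (fun _ => hG x)]
    simp only [Finset.sum_const, Finset.card_univ, Fintype.card_fin, nsmul_eq_mul]
    rw [← mul_assoc, ENNReal.ofReal_mul (by positivity)]
    gcongr
    rw [← ofReal_integral_eq_lintegral_ofReal (hG x).integrable_sq
      (Filter.Eventually.of_forall fun _ => sq_nonneg _)]
    apply ENNReal.ofReal_le_ofReal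
    exact variance_le_expectation_sq (hG x).aestronglyMeasurable
  refine (lintegral_mono key).trans ?_
  have hGm : Measurable (fun p : (Fin d → ℝ) × (Fin d → ℝ) => ENNReal.ofReal (G p.1 p.2 ^ 2)) := by
    fun_prop
  rw [lintegral_const_mul _ hGm.lintegral_prod_right', lintegral_lintegral_swap hGm.aemeasurable]
  simp only [G, lint_prodK d _ h hh]
  rw [lintegral_const, measure_univ, mul_one, ← ENNReal.ofReal_mul (by positivity)]
  apply ENNReal.ofReal_le_ofReal
  apply le_of_eq
  rw [Real.rpow_neg Real.pi_pos.le, Real.rpow_natCast, hc]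
  have := Real.pi_ne_zero
  field_simp
  rw [← mul_pow, div_mul_cancel₀ _ this]
end
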